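/- Let M = ⟨W, {R_i}_{i∈Λ}, V⟩ be a Kripke model, w ∈ W, and φ a μ-formula in which each variable occurs once and is bound by a fixed-point operator. Then M,w ⊨ φ if and only if Verifier has a winning strategy in the evaluation game 𝒢(M, w ⊨ φ); and M,w ⊭ φ if and only if Refuter has a winning strategy in 𝒢(M, w ⊨ φ). -/

import Mathlib

/- ### μ-calculus: syntax and Kripke semantics -/

/-- μ-formulas over a modal signature `Λ`, with propositional symbols and
variables indexed by `ℕ`; negation applies to propositional symbols only. -/
inductive MuForm (Λ : Type) : Type where
  | prop : ℕ → MuForm Λ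
  | nprop : ℕ → MuForm Λ
  | var : ℕ → MuForm Λ
  | and : MuForm Λ → MuForm Λ → MuForm Λ
  | or : MuForm Λ → MuForm Λ → MuForm Λ
  | box : Λ → MuForm Λ → MuForm Λ
  | dia : Λ → MuForm Λ → MuForm Λ
  | mu : ℕ → MuForm Λ → MuForm Λ
  | nu : ℕ → MuForm Λ → MuForm Λ

/-- A Kripke model over signature `Λ` with set of worlds `W`. -/
structure KModel (Λ W : Type) where
  R : Λ → W → W → Prop
  V : ℕ → Set W

namespace MuForm

variable {Λ W : Type}

/-- The valuation `‖φ‖^M` of a μ-formula, where `env` interprets the variables;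
least and greatest fixed points are taken in the complete lattice `Set W`. -/
def sem (M : KModel Λ W) (env : ℕ → Set W) : MuForm Λ → Set W
  | prop p => M.V p
  | nprop p => (M.V p)ᶜ
  | var x => env x
  | and a b => sem M env a ∩ sem M env b
  | or a b => sem M env a ∪ sem M env b
  | box i a => {w | ∀ v, M.R i w v → v ∈ sem M env a}
  | dia i a => {w | ∃ v, M.R i w v ∧ v ∈ sem M env a}
  | mu x a => sInf {A : Set W | sem M (Function.update env x A) a ⊆ A}
  | nu x a => sSup {A : Set W | A ⊆ sem M (Function.update env x A) a}

/-- Free variables of a μ-formula. -/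
def freeVars : MuForm Λ → Set ℕ
  | prop _ => ∅
  | nprop _ => ∅
  | var x => {x}
  | and a b => freeVars a ∪ freeVars b
  | or a b => freeVars a ∪ freeVars b
  | box _ a => freeVars a
  | dia _ a => freeVars a
  | mu x a => freeVars a \ {x}
  | nu x a => freeVars a \ {x}

/-- A μ-formula contains no fixed-point operators. -/
def noFix : MuForm Λ → Prop
  | prop _ => True
  | nprop _ => True
  | var _ => True
  | and a b => noFix a ∧ noFix b
  | or a b => noFix a ∧ noFix b
  | box _ a => noFix a
  | dia _ a => noFix a
  | mu _ _ => False
  | nu _ _ => False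

/-- The list of subformulas of a μ-formula. -/
def subfs : MuForm Λ → List (MuForm Λ)
  | prop p => [prop p]
  | nprop p => [nprop p]
  | var x => [var x]
  | and a b => (and a b) :: (subfs a ++ subfs b)
  | or a b => (or a b) :: (subfs a ++ subfs b)
  | box i a => (box i a) :: subfs a
  | dia i a => (dia i a) :: subfs a
  | mu x a => (mu x a) :: subfs a
  | nu x a => (nu x a) :: subfs a

/-- Substitution of `ψ` for the free occurrences of the variable `X`. -/
def subst (X : ℕ) (ψ : MuForm Λ) : MuForm Λ → MuForm Λ
  | prop p => prop p
  | nprop p => nprop p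
  | var y => if y = X then ψ else var y
  | and a b => and (subst X ψ a) (subst X ψ b)
  | or a b => or (subst X ψ a) (subst X ψ b)
  | box i a => box i (subst X ψ a)
  | dia i a => dia i (subst X ψ a)
  | mu y a => if y = X then mu y a else mu y (subst X ψ a)
  | nu y a => if y = X then nu y a else nu y (subst X ψ a)

/-- The substitution of `ψ` for `X` is capture-free: no free variable of `ψ`
becomes bound when substituting `ψ` for the free occurrences of `X`. -/
def CaptureFree (X : ℕ) (ψ : MuForm Λ) : MuForm Λ → Prop
  | prop _ => True
  | nprop _ => True
  | var _ => True
  | and a b => CaptureFree X ψ a ∧ CaptureFree X ψ b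
  | or a b => CaptureFree X ψ a ∧ CaptureFree X ψ b
  | box _ a => CaptureFree X ψ a
  | dia _ a => CaptureFree X ψ a
  | mu y a => y = X ∨ ((X ∈ freeVars a → y ∉ freeVars ψ) ∧ CaptureFree X ψ a)
  | nu y a => y = X ∨ ((X ∈ freeVars a → y ∉ freeVars ψ) ∧ CaptureFree X ψ a)

/-- Number of occurrences of the variable `X`. -/
def varCnt (X : ℕ) : MuForm Λ → ℕ
  | prop _ => 0
  | nprop _ => 0
  | var y => if y = X then 1 else 0
  | and a b => varCnt X a + varCnt X b
  | or a b => varCnt X a + varCnt X b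
  | box _ a => varCnt X a
  | dia _ a => varCnt X a
  | mu _ a => varCnt X a
  | nu _ a => varCnt X a

/-- Number of fixed-point binders binding the variable `X`. -/
def bndCnt (X : ℕ) : MuForm Λ → ℕ
  | prop _ => 0
  | nprop _ => 0
  | var _ => 0
  | and a b => bndCnt X a + bndCnt X b
  | or a b => bndCnt X a + bndCnt X b
  | box _ a => bndCnt X a
  | dia _ a => bndCnt X a
  | mu y a => (if y = X then 1 else 0) + bndCnt X a
  | nu y a => (if y = X then 1 else 0) + bndCnt X a

end MuForm

/-- Each variable has at most one occurrence, is bound by at most one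
fixed-point operator, and no variable occurs free. -/
def WellNamed {Λ : Type} (φ : MuForm Λ) : Prop :=
  (∀ X : ℕ, MuForm.varCnt X φ ≤ 1 ∧ MuForm.bndCnt X φ ≤ 1) ∧ MuForm.freeVars φ = ∅

/- ### The alternation hierarchy Σ^μ_n / Π^μ_n -/

mutual
  /-- The class `Σ^μ_n` of the alternation hierarchy. -/
  inductive SigmaMu {Λ : Type} : ℕ → MuForm Λ → Prop where
    | base {φ : MuForm Λ} : φ.noFix → SigmaMu 0 φ
    | upS {n : ℕ} {φ : MuForm Λ} : SigmaMu n φ → SigmaMu (n + 1) φ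
    | upP {n : ℕ} {φ : MuForm Λ} : PiMu n φ → SigmaMu (n + 1) φ
    | andI {n : ℕ} {a b : MuForm Λ} :
        SigmaMu (n + 1) a → SigmaMu (n + 1) b → SigmaMu (n + 1) (MuForm.and a b)
    | orI {n : ℕ} {a b : MuForm Λ} :
        SigmaMu (n + 1) a → SigmaMu (n + 1) b → SigmaMu (n + 1) (MuForm.or a b)
    | boxI {n : ℕ} {i : Λ} {a : MuForm Λ} :
        SigmaMu (n + 1) a → SigmaMu (n + 1) (MuForm.box i a)
    | diaI {n : ℕ} {i : Λ} {a : MuForm Λ} :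
        SigmaMu (n + 1) a → SigmaMu (n + 1) (MuForm.dia i a)
    | muI {n : ℕ} {X : ℕ} {a : MuForm Λ} :
        SigmaMu (n + 1) a → SigmaMu (n + 1) (MuForm.mu X a)
    | substI {n : ℕ} {X : ℕ} {a ψ : MuForm Λ} :
        SigmaMu (n + 1) a → SigmaMu (n + 1) ψ → MuForm.CaptureFree X ψ a →
        SigmaMu (n + 1) (MuForm.subst X ψ a)

  /-- The class `Π^μ_n` of the alternation hierarchy. -/
  inductive PiMu {Λ : Type} : ℕ → MuForm Λ → Prop where
    | base {φ : MuForm Λ} : φ.noFix → PiMu 0 φ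
    | upS {n : ℕ} {φ : MuForm Λ} : SigmaMu n φ → PiMu (n + 1) φ
    | upP {n : ℕ} {φ : MuForm Λ} : PiMu n φ → PiMu (n + 1) φ
    | andI {n : ℕ} {a b : MuForm Λ} :
        PiMu (n + 1) a → PiMu (n + 1) b → PiMu (n + 1) (MuForm.and a b)
    | orI {n : ℕ} {a b : MuForm Λ} :
        PiMu (n + 1) a → PiMu (n + 1) b → PiMu (n + 1) (MuForm.or a b)
    | boxI {n : ℕ} {i : Λ} {a : MuForm Λ} :
        PiMu (n + 1) a → PiMu (n + 1) (MuForm.box i a)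
    | diaI {n : ℕ} {i : Λ} {a : MuForm Λ} :
        PiMu (n + 1) a → PiMu (n + 1) (MuForm.dia i a)
    | nuI {n : ℕ} {X : ℕ} {a : MuForm Λ} :
        PiMu (n + 1) a → PiMu (n + 1) (MuForm.nu X a)
    | substI {n : ℕ} {X : ℕ} {a ψ : MuForm Λ} :
        PiMu (n + 1) a → PiMu (n + 1) ψ → MuForm.CaptureFree X ψ a →
        PiMu (n + 1) (MuForm.subst X ψ a)
end

/- ### Kripke frames, closure conditions, fusions, equivalence -/

/-- A Kripke frame over the signature `Λ`. -/
structure Frame (Λ : Type) : Type 1 where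
  World : Type
  R : Λ → World → World → Prop

/-- Frame isomorphism. -/
def FrameIso {Λ : Type} (F G : Frame Λ) : Prop :=
  ∃ e : F.World ≃ G.World, ∀ (i : Λ) (w v : F.World), F.R i w v ↔ G.R i (e w) (e v)

/-- A class of frames is closed under isomorphic copies. -/
def ClosedUnderIso {Λ : Type} (C : Set (Frame Λ)) : Prop :=
  ∀ F ∈ C, ∀ G : Frame Λ, FrameIso F G → G ∈ C

/-- Disjoint union of a family of frames. -/
def Frame.disjUnion {Λ ι : Type} (f : ι → Frame Λ) : Frame Λ where
  World := Σ i : ι, (f i).World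
  R m x y :=
    ∃ h : x.1 = y.1, (f y.1).R m (cast (congrArg (fun i => (f i).World) h) x.2) y.2

/-- A class of frames is closed under disjoint unions. -/
def ClosedUnderDU {Λ : Type} (C : Set (Frame Λ)) : Prop :=
  ∀ (ι : Type) (f : ι → Frame Λ), (∀ i, f i ∈ C) → Frame.disjUnion f ∈ C

/-- `∘→∘` is a subframe of the class `C` of unimodal frames. -/
def HasEdge (C : Set (Frame Unit)) : Prop :=
  ∃ F ∈ C, ∃ w0 w1 : F.World, w0 ≠ w1 ∧ F.R () w0 w1

/-- `∘←∘→∘` is a subframe of the class `C` of unimodal frames. -/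
def HasFork (C : Set (Frame Unit)) : Prop :=
  ∃ F ∈ C, ∃ w0 w1 w2 : F.World,
    w0 ≠ w1 ∧ w0 ≠ w2 ∧ w1 ≠ w2 ∧ F.R () w0 w1 ∧ F.R () w0 w2

/-- `∘→∘→∘` is a subframe of the class `C` of unimodal frames. -/
def HasChain2 (C : Set (Frame Unit)) : Prop :=
  ∃ F ∈ C, ∃ w0 w1 w2 : F.World,
    w0 ≠ w1 ∧ w0 ≠ w2 ∧ w1 ≠ w2 ∧ F.R () w0 w1 ∧ F.R () w1 w2

/-- The unimodal reduct of a bimodal frame. -/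
def Frame.reduct2 (F : Frame (Fin 2)) (i : Fin 2) : Frame Unit :=
  ⟨F.World, fun _ => F.R i⟩

/-- Fusion of two classes of unimodal frames (signatures `{0}` and `{1}`). -/
def fusion2 (C0 C1 : Set (Frame Unit)) : Set (Frame (Fin 2)) :=
  {F | F.reduct2 0 ∈ C0 ∧ F.reduct2 1 ∈ C1}

/-- The unimodal reduct of a trimodal frame. -/
def Frame.reduct3 (F : Frame (Fin 3)) (i : Fin 3) : Frame Unit :=
  ⟨F.World, fun _ => F.R i⟩

/-- Fusion of three classes of unimodal frames. -/
def fusion3 (C0 C1 C2 : Set (Frame Unit)) : Set (Frame (Fin 3)) :=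
  {F | F.reduct3 0 ∈ C0 ∧ F.reduct3 1 ∈ C1 ∧ F.reduct3 2 ∈ C2}

/-- Two μ-formulas are equivalent over a class of frames: they have the same
valuation in every model based on a frame of the class. -/
def EquivOver {Λ : Type} (C : Set (Frame Λ)) (φ ψ : MuForm Λ) : Prop :=
  ∀ F ∈ C, ∀ (V : ℕ → Set F.World) (env : ℕ → Set F.World),
    MuForm.sem ⟨F.R, V⟩ env φ = MuForm.sem ⟨F.R, V⟩ env ψ

/- ### Games, strategies, evaluation games, parity games -/

/-- A two-player game on a graph: positions owned by `ownV` belong to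
Verifier/∃, the others to Refuter/∀; `winV` decides infinite plays.
A player who cannot move loses. -/
structure Game (Pos : Type) where
  init : Pos
  ownV : Pos → Prop
  move : Pos → Pos → Prop
  winV : (ℕ → Pos) → Prop

/-- The history (current position first) of an infinite play after `n` steps. -/
def histN {Pos : Type} (p : ℕ → Pos) (n : ℕ) : List Pos :=
  ((List.range (n + 1)).map p).reverse

/-- Finite histories (current position first) of plays in which the player
owning the `own`-positions follows the strategy `σ`. -/
inductive Game.Hist {Pos : Type} (G : Game Pos) (own : Pos → Prop)
    (σ : List Pos → Pos) : List Pos → Prop where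
  | init : Game.Hist G own σ [G.init]
  | smove {l : List Pos} {x : Pos} : Game.Hist G own σ (x :: l) → own x →
      G.move x (σ (x :: l)) → Game.Hist G own σ (σ (x :: l) :: x :: l)
  | omove {l : List Pos} {x y : Pos} : Game.Hist G own σ (x :: l) → ¬ own x →
      G.move x y → Game.Hist G own σ (y :: x :: l)

/-- The player owning the `own`-positions has a winning strategy:
a strategy which always provides a legal move at reachable own positions
(so the player is never stuck) and such that every infinite play following it
satisfies the winning condition `winO`; finite plays in which the opponent is
stuck are automatically won. -/
def Game.WinsFor {Pos : Type} (G : Game Pos) (own : Pos → Prop)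
    (winO : (ℕ → Pos) → Prop) : Prop :=
  ∃ σ : List Pos → Pos,
    (∀ (l : List Pos) (x : Pos), G.Hist own σ (x :: l) → own x →
      G.move x (σ (x :: l))) ∧
    (∀ p : ℕ → Pos, p 0 = G.init → (∀ n, G.move (p n) (p (n + 1))) →
      (∀ n, own (p n) → p (n + 1) = σ (histN p n)) → winO p)

/-- Verifier has a winning strategy. -/
def Game.VWins {Pos : Type} (G : Game Pos) : Prop := G.WinsFor G.ownV G.winV

/-- Refuter has a winning strategy. -/
def Game.RWins {Pos : Type} (G : Game Pos) : Prop :=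
  G.WinsFor (fun x => ¬ G.ownV x) (fun p => ¬ G.winV p)

/-- Ownership of positions in the evaluation game `𝒢(M, w ⊨ φ0)`:
Verifier owns disjunctions, diamonds, μ-formulas, μ-bound variables and
false literals. -/
def evalOwnV {Λ W : Type} (M : KModel Λ W) (φ0 : MuForm Λ) :
    MuForm Λ × W → Prop := fun q =>
  match q with
  | (.or _ _, _) => True
  | (.dia _ _, _) => True
  | (.mu _ _, _) => True
  | (.var X, _) => ∃ a : MuForm Λ, (MuForm.mu X a) ∈ φ0.subfs
  | (.prop p, w) => w ∉ M.V p
  | (.nprop p, w) => w ∈ M.V p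
  | _ => False

/-- Admissible moves in the evaluation game `𝒢(M, w ⊨ φ0)`. -/
def evalMove {Λ W : Type} (M : KModel Λ W) (φ0 : MuForm Λ) :
    MuForm Λ × W → MuForm Λ × W → Prop := fun q r =>
  match q with
  | (.and a b, w) => r = (a, w) ∨ r = (b, w)
  | (.or a b, w) => r = (a, w) ∨ r = (b, w)
  | (.box i a, w) => ∃ v, M.R i w v ∧ r = (a, v)
  | (.dia i a, w) => ∃ v, M.R i w v ∧ r = (a, v)
  | (.mu _ a, w) => r = (a, w)
  | (.nu _ a, w) => r = (a, w)
  | (.var X, w) =>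
      ∃ a : MuForm Λ,
        ((MuForm.mu X a) ∈ φ0.subfs ∧ r = (MuForm.mu X a, w)) ∨
        ((MuForm.nu X a) ∈ φ0.subfs ∧ r = (MuForm.nu X a, w))
  | (.prop _, _) => False
  | (.nprop _, _) => False

/-- The formula `ψ` labels infinitely many positions of the infinite run `p`. -/
def InfOccF {Λ W : Type} (p : ℕ → MuForm Λ × W) (ψ : MuForm Λ) : Prop :=
  ∀ n, ∃ m, n ≤ m ∧ (p m).1 = ψ

/-- Verifier wins an infinite run iff the outermost fixed-point subformula
occurring infinitely often is a ν-formula. -/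
def evalWinV {Λ W : Type} (p : ℕ → MuForm Λ × W) : Prop :=
  ∃ (X : ℕ) (a : MuForm Λ), InfOccF p (MuForm.nu X a) ∧
    ∀ χ : MuForm Λ, InfOccF p χ → χ ∈ (MuForm.nu X a).subfs

/-- The evaluation game `𝒢(M, w ⊨ φ)`. -/
def evalGame {Λ W : Type} (M : KModel Λ W) (w : W) (φ : MuForm Λ) :
    Game (MuForm Λ × W) where
  init := (φ, w)
  ownV := evalOwnV M φ
  move := evalMove M φ
  winV := evalWinV

/-- A parity game. -/
structure PGame : Type 1 where
  Pos : Type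
  ownE : Pos → Prop
  init : Pos
  E : Pos → Pos → Prop
  Ω : Pos → ℕ

/-- The parity `k` occurs infinitely often in the infinite play `p`. -/
def InfOccPar (P : PGame) (p : ℕ → P.Pos) (k : ℕ) : Prop :=
  ∀ n, ∃ m, n ≤ m ∧ P.Ω (p m) = k

/-- A parity game as a game: ∃ wins an infinite play iff the greatest parity
occurring infinitely often is even. -/
def PGame.toGame (P : PGame) : Game P.Pos where
  init := P.init
  ownV := P.ownE
  move := P.E
  winV := fun p => ∃ k, Even k ∧ InfOccPar P p k ∧ ∀ j, InfOccPar P p j → j ≤ k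

/-- Player ∃ wins the parity game. -/
def PGame.ExWins (P : PGame) : Prop := P.toGame.VWins

/-- Player ∀ wins the parity game. -/
def PGame.AWins (P : PGame) : Prop := P.toGame.RWins

/-- The parity of a fixed-point formula: `2(i+ε) − 1` for a μ-formula in
`Σ^μ_{2i+ε} \ Π^μ_{2i+ε}`, `2i` for a ν-formula in `Π^μ_{2i+ε} \ Σ^μ_{2i+ε}`,
and `0` for non fixed-point formulas. -/
noncomputable def fpParity {Λ : Type} : MuForm Λ → ℕ := fun φ =>
  match φ with
  | .mu _ _ =>
      (fun ℓ => if Even ℓ then ℓ - 1 else ℓ) (sInf {k | SigmaMu k φ ∧ ¬ PiMu k φ})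
  | .nu _ _ =>
      (fun ℓ => if Even ℓ then ℓ else ℓ - 1) (sInf {k | PiMu k φ ∧ ¬ SigmaMu k φ})
  | _ => 0

/-- The evaluation game `𝒢(M, w ⊨ φ)` presented as the parity game
`𝒢^P(M, w ⊨ φ)`. -/
noncomputable def evalPGame {Λ W : Type} (M : KModel Λ W) (w : W)
    (φ : MuForm Λ) : PGame where
  Pos := MuForm Λ × W
  ownE := evalOwnV M φ
  init := (φ, w)
  E := evalMove M φ
  Ω := fun q => fpParity q.1

/- ### Tree unfolding of a parity game -/

/-- Finite `E`-paths of a parity game starting at the initial position,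
presented as (last vertex, reversed list of earlier vertices). -/
inductive IsUPath (P : PGame) : P.Pos × List P.Pos → Prop where
  | init : IsUPath P (P.init, [])
  | cons {u : P.Pos} {t : List P.Pos} {v : P.Pos} :
      IsUPath P (u, t) → P.E u v → IsUPath P (v, u :: t)

/-- The tree unfolding of a parity game: positions are the finite `E`-paths
starting at the initial position, with ownership and parity inherited from
the last vertex. -/
def PGame.unfold (P : PGame) : PGame where
  Pos := {q : P.Pos × List P.Pos // IsUPath P q}
  ownE := fun q => P.ownE q.val.1
  init := ⟨(P.init, []), IsUPath.init⟩
  E := fun q r => r.val.2 = q.val.1 :: q.val.2 ∧ P.E q.val.1 r.val.1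
  Ω := fun q => P.Ω q.val.1

/- ### The Kripke encoding of parity games and the formulas W_n -/

/- Propositional indices used for the encoding:
`bd = 0`, `pos = 1`, `pre₀ = 2`, `nxt₀ = 3`, `pre₁ = 4`, `nxt₁ = 5`,
`P_∃ = 6`, `P_∀ = 7`, `P_j = 8 + j`. -/

/-- Worlds of the Kripke model encoding a parity game: a world `pos v` for
each position `v`, and intermediate choice/confirmation worlds `mid u u'`
for the edges. -/
inductive EncW (Pos : Type) : Type where
  | pos : Pos → EncW Pos
  | mid : Pos → Pos → EncW Pos

/-- Choice steps (`R₀`) of the encoding. -/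
def encR0 (P : PGame) : EncW P.Pos → EncW P.Pos → Prop
  | EncW.pos v, EncW.mid u u' => v = u ∧ P.E u u'
  | _, _ => False

/-- Confirmation steps (`R₁`) of the encoding. -/
def encR1 (P : PGame) : EncW P.Pos → EncW P.Pos → Prop
  | EncW.mid u u', EncW.pos v => v = u' ∧ P.E u u'
  | _, _ => False

/-- Valuation of the encoding. -/
def encV (P : PGame) : ℕ → Set (EncW P.Pos) := fun n =>
  if n = 0 then Set.univ                                         -- bd
  else if n = 1 then {x | ∃ v, x = EncW.pos v}                   -- pos
  else if n = 2 then {x | ∃ v, x = EncW.pos v}                   -- pre₀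
  else if n = 3 then {x | ∃ u u', x = EncW.mid u u'}             -- nxt₀
  else if n = 4 then {x | ∃ u u', x = EncW.mid u u'}             -- pre₁
  else if n = 5 then {x | ∃ v, x = EncW.pos v}                   -- nxt₁
  else if n = 6 then {x | ∃ v, x = EncW.pos v ∧ P.ownE v}        -- P_∃
  else if n = 7 then {x | ∃ v, x = EncW.pos v ∧ ¬ P.ownE v}      -- P_∀
  else {x | ∃ v, x = EncW.pos v ∧ P.Ω v = n - 8}                 -- P_{n-8}

/-- The bimodal Kripke model `P^K` encoding the parity game `P`. -/
def encModel (P : PGame) : KModel (Fin 2) (EncW P.Pos) where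
  R := fun i => if i = 0 then encR0 P else encR1 P
  V := encV P

/-- `♦φ := νY. pre₀ ∧ bd ∧ ◇₀(nxt₀ ∧ pre₁ ∧ bd ∧ ◇₁(nxt₁ ∧ bd ∧
((Y ∧ ¬pos) ∨ (φ ∧ pos))))`. -/
def DiamW (Y : ℕ) (φ : MuForm (Fin 2)) : MuForm (Fin 2) :=
  .nu Y (.and (.prop 2) (.and (.prop 0)
    (.dia 0 (.and (.prop 3) (.and (.prop 4) (.and (.prop 0)
      (.dia 1 (.and (.prop 5) (.and (.prop 0)
        (.or (.and (.var Y) (.nprop 1)) (.and φ (.prop 1))))))))))))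

/-- `■φ := νY. (pre₀ ∧ bd → □₀(nxt₀ ∧ pre₁ ∧ bd → □₁(nxt₁ ∧ bd →
((Y ∧ ¬pos) ∧ (φ ∧ pos)))))`, implications written disjunctively. -/
def BoxW (Y : ℕ) (φ : MuForm (Fin 2)) : MuForm (Fin 2) :=
  .nu Y (.or (.or (.nprop 2) (.nprop 0))
    (.box 0 (.or (.or (.nprop 3) (.or (.nprop 4) (.nprop 0)))
      (.box 1 (.or (.or (.nprop 5) (.nprop 0))
        (.and (.and (.var Y) (.nprop 1)) (.and φ (.prop 1))))))))

/-- The `j`-th disjunct `(P_j ∧ P_∃ ∧ ♦X_j) ∨ (P_j ∧ P_∀ ∧ ■X_j)`. -/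
def WDisj (Y j : ℕ) : MuForm (Fin 2) :=
  .or (.and (.prop (8 + j)) (.and (.prop 6) (DiamW Y (.var j))))
      (.and (.prop (8 + j)) (.and (.prop 7) (BoxW Y (.var j))))

/-- The disjunction `⋁_{0 ≤ j ≤ n} [(P_j ∧ P_∃ ∧ ♦X_j) ∨ (P_j ∧ P_∀ ∧ ■X_j)]`. -/
def WBody (Y : ℕ) : ℕ → MuForm (Fin 2)
  | 0 => WDisj Y 0
  | j + 1 => .or (WBody Y (j)) (WDisj Y (j + 1))

/-- The alternating block of binders `ηX_n … νX_2 μX_1 νX_0`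
(`νX_j` for even `j`, `μX_j` for odd `j`). -/
def WBind : ℕ → MuForm (Fin 2) → MuForm (Fin 2)
  | 0, φ => .nu 0 φ
  | j + 1, φ =>
      if Even (j + 1) then .nu (j + 1) (WBind j φ) else .mu (j + 1) (WBind j φ)

/-- The winning region formula
`W_n := ηX_n … νX_2 μX_1 νX_0. ⋁_{0≤j≤n} [(P_j ∧ P_∃ ∧ ♦X_j) ∨ (P_j ∧ P_∀ ∧ ■X_j)]`,
where the fresh variable `Y` of `♦`/`■` is `n + 1`. -/
def Wfml (n : ℕ) : MuForm (Fin 2) := WBind n (WBody (n + 1) n)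

/- ### Pointed bimodal models, restriction, isomorphisms, the map f_φ -/

/-- A pointed bimodal Kripke model. -/
structure PModel : Type 1 where
  World : Type
  R0 : World → World → Prop
  R1 : World → World → Prop
  V : ℕ → Set World
  pt : World

/-- The underlying bimodal Kripke model. -/
def PModel.toK (M : PModel) : KModel (Fin 2) M.World :=
  ⟨fun i => if i = 0 then M.R0 else M.R1, M.V⟩

/-- The edges of the graph of a pointed bimodal model. -/
def PModel.edge (M : PModel) (x y : M.World) : Prop := M.R0 x y ∨ M.R1 x y

/-- The graph of the model has no loops. -/
def PModel.Acyclic (M : PModel) : Prop :=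
  ∀ x : M.World, ¬ Relation.TransGen M.edge x x

/-- Reachability in at most `k` steps. -/
def stepsLe (M : PModel) : ℕ → M.World → M.World → Prop
  | 0 => fun x y => x = y
  | k + 1 => fun x y => stepsLe M k x y ∨ ∃ u, stepsLe M k x u ∧ M.edge u y

/-- The worlds at distance less than `n` from the distinguished point. -/
def PModel.ball (M : PModel) (n : ℕ) : Set M.World :=
  {v | ∃ k, k + 1 ≤ n ∧ stepsLe M k M.pt v}

/-- `e` is an isomorphism between the restrictions `(M↾n, w)` and `(M'↾n, w')`,
i.e. an `n`-isomorphism. -/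
structure IsNIso (M M' : PModel) (n : ℕ)
    (e : {x // x ∈ M.ball n} ≃ {x // x ∈ M'.ball n}) : Prop where
  pt : ∀ hx : M.pt ∈ M.ball n, (e ⟨M.pt, hx⟩).val = M'.pt
  r0 : ∀ x y : {x // x ∈ M.ball n}, M.R0 x.val y.val ↔ M'.R0 (e x).val (e y).val
  r1 : ∀ x y : {x // x ∈ M.ball n}, M.R1 x.val y.val ↔ M'.R1 (e x).val (e y).val
  vals : ∀ (p : ℕ) (x : {x // x ∈ M.ball n}), x.val ∈ M.V p ↔ (e x).val ∈ M'.V p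

/-- The pointed models are `n`-isomorphic. -/
def NIsomorphic (M M' : PModel) (n : ℕ) : Prop := ∃ e, IsNIso M M' n e

/-- `e` is an isomorphism of pointed bimodal models. -/
structure IsIsoP (M M' : PModel) (e : M.World ≃ M'.World) : Prop where
  pt : e M.pt = M'.pt
  r0 : ∀ x y : M.World, M.R0 x y ↔ M'.R0 (e x) (e y)
  r1 : ∀ x y : M.World, M.R1 x y ↔ M'.R1 (e x) (e y)
  vals : ∀ (p : ℕ) (x : M.World), x ∈ M.V p ↔ e x ∈ M'.V p

/-- The pointed models are isomorphic. -/
def IsomorphicP (M M' : PModel) : Prop := ∃ e, IsIsoP M M' e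

/-- The map `f_φ` sending a pointed bimodal model `(M, w)` to the pointed
Kripke model `(𝒢^K(M, w ⊨ φ), ⟨φ, w⟩)` representing its evaluation game,
where `𝒢^K(M, w ⊨ φ) = (𝒢^P(M, w ⊨ φ))^K`. -/
noncomputable def fGame (φ : MuForm (Fin 2)) (M : PModel) : PModel where
  World := EncW (MuForm (Fin 2) × M.World)
  R0 := encR0 (evalPGame M.toK M.pt φ)
  R1 := encR1 (evalPGame M.toK M.pt φ)
  V := encV (evalPGame M.toK M.pt φ)
  pt := EncW.pos (φ, M.pt)

/- ### Modal logics, fusions of logics, GLP -/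

/-- Modal formulas (no fixed points) over a signature `I`, with full
implication and falsum. -/
inductive MForm (I : Type) : Type where
  | prop : ℕ → MForm I
  | fls : MForm I
  | imp : MForm I → MForm I → MForm I
  | box : I → MForm I → MForm I

namespace MForm

variable {I : Type}

def neg (a : MForm I) : MForm I := a.imp .fls

def conj (a b : MForm I) : MForm I := (a.imp b.neg).neg

def diam (i : I) (a : MForm I) : MForm I := (MForm.box i a.neg).neg

def iff (a b : MForm I) : MForm I := conj (a.imp b) (b.imp a)

/-- Kripke semantics for modal formulas. -/
def semM {W : Type} (R : I → W → W → Prop) (V : ℕ → Set W) : MForm I → Set W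
  | prop p => V p
  | fls => ∅
  | imp a b => {w | w ∈ semM R V a → w ∈ semM R V b}
  | box i a => {w | ∀ v, R i w v → v ∈ semM R V a}

/-- Uniform substitution of formulas for propositional symbols. -/
def substP (σ : ℕ → MForm I) : MForm I → MForm I
  | prop p => σ p
  | fls => fls
  | imp a b => imp (substP σ a) (substP σ b)
  | box i a => box i (substP σ a)

/-- The formula only uses modalities from `S`. -/
def UsesOnly (S : Set I) : MForm I → Prop
  | prop _ => True
  | fls => True
  | imp a b => UsesOnly S a ∧ UsesOnly S b
  | box i a => i ∈ S ∧ UsesOnly S a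

/-- The propositional symbol `x` occurs in the formula. -/
def PropOccurs (x : ℕ) : MForm I → Prop
  | prop p => p = x
  | fls => False
  | imp a b => PropOccurs x a ∨ PropOccurs x b
  | box _ a => PropOccurs x a

/-- Every occurrence of the propositional symbol `x` is within the scope of
some modality. -/
def Guarded (x : ℕ) : MForm I → Prop
  | prop p => p ≠ x
  | fls => True
  | imp a b => Guarded x a ∧ Guarded x b
  | box _ _ => True

end MForm

/-- Propositional tautologies: formulas true under every boolean valuation
treating propositional symbols and boxed formulas as atoms. -/
def IsTaut {I : Type} (φ : MForm I) : Prop :=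
  ∀ val : MForm I → Prop, ¬ val .fls →
    (∀ a b : MForm I, val (a.imp b) ↔ (val a → val b)) → val φ

/-- A modal formula is valid on a frame: it holds at every world under
every valuation. -/
def ValidOn {I : Type} (F : Frame I) (φ : MForm I) : Prop :=
  ∀ (V : ℕ → Set F.World) (w : F.World), w ∈ MForm.semM F.R V φ

/-- `L` is a normal modal logic in the signature `S`. -/
structure IsNormalIn {I : Type} (S : Set I) (L : Set (MForm I)) : Prop where
  inSig : ∀ φ ∈ L, MForm.UsesOnly S φ
  taut : ∀ φ : MForm I, MForm.UsesOnly S φ → IsTaut φ → φ ∈ L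
  axK : ∀ i ∈ S, ∀ a b : MForm I, MForm.UsesOnly S a → MForm.UsesOnly S b →
    ((MForm.box i (a.imp b)).imp ((MForm.box i a).imp (MForm.box i b))) ∈ L
  mp : ∀ a b : MForm I, a ∈ L → (a.imp b) ∈ L → b ∈ L
  nec : ∀ i ∈ S, ∀ a : MForm I, a ∈ L → MForm.box i a ∈ L
  subst : ∀ σ : ℕ → MForm I, (∀ p, MForm.UsesOnly S (σ p)) →
    ∀ a ∈ L, a.substP σ ∈ L

/-- The fusion of a family of modal logics: the smallest normal modal logic
in the combined signature containing each of them. -/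
def FusionLogic {I J : Type} (Ls : J → Set (MForm I)) : Set (MForm I) :=
  ⋂₀ {L : Set (MForm I) | IsNormalIn Set.univ L ∧ ∀ j, Ls j ⊆ L}

/-- Extension of a frame for the `j`-th component signature to the full
signature (the other relations are empty; validity of formulas in the
component signature is unaffected). -/
def extendFrame {I J : Type} (c : I → J) (j : J)
    (F : Frame {i : I // c i = j}) : Frame I :=
  ⟨F.World, fun i w v => ∃ h : c i = j, F.R ⟨i, h⟩ w v⟩

/-- The reduct of a frame for the full signature to the `j`-th component. -/
def Frame.reductTo {I J : Type} (c : I → J) (j : J) (F : Frame I) :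
    Frame {i : I // c i = j} :=
  ⟨F.World, fun i => F.R i.val⟩

/-- `L` is characterized by the class `Fs` of frames in the `j`-th component
signature: `L` consists exactly of the formulas of that signature valid on
every frame of `Fs`. -/
def CharacterizedBy {I J : Type} (c : I → J) (j : J) (L : Set (MForm I))
    (Fs : Set (Frame {i : I // c i = j})) : Prop :=
  L = {φ | MForm.UsesOnly {i | c i = j} φ ∧
        ∀ F ∈ Fs, ValidOn (extendFrame c j F) φ}

/-- The fusion of classes of frames in pairwise disjoint signatures. -/
def FusionFrames {I J : Type} (c : I → J)
    (Fs : ∀ j : J, Set (Frame {i : I // c i = j})) : Set (Frame I) :=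
  {F | ∀ j, F.reductTo c j ∈ Fs j}

/-- The finite model property for a logic in signature `S`. -/
def HasFMP {I : Type} (S : Set I) (L : Set (MForm I)) : Prop :=
  ∀ φ : MForm I, MForm.UsesOnly S φ → φ ∉ L →
    ∃ (W : Type) (_ : Finite W) (R : I → W → W → Prop) (V : ℕ → Set W),
      (∀ ψ ∈ L, ∀ w : W, w ∈ MForm.semM R V ψ) ∧ ∃ w : W, w ∉ MForm.semM R V φ

/-- The provability logic `GLP` (signature `ℕ`). -/
inductive GLPthm : MForm ℕ → Prop where
  | taut {φ : MForm ℕ} : IsTaut φ → GLPthm φ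
  | axK (n : ℕ) (a b : MForm ℕ) :
      GLPthm ((MForm.box n (a.imp b)).imp ((MForm.box n a).imp (MForm.box n b)))
  | axLob (n : ℕ) (a : MForm ℕ) :
      GLPthm ((MForm.box n ((MForm.box n a).imp a)).imp (MForm.box n a))
  | axMono {m n : ℕ} (h : m ≤ n) (a : MForm ℕ) :
      GLPthm ((MForm.box m a).imp (MForm.box n a))
  | axStab {m n : ℕ} (h : m ≤ n) (a : MForm ℕ) :
      GLPthm ((MForm.box m a).imp (MForm.box n (MForm.box m a)))
  | axStabD {m n : ℕ} (h : m ≤ n) (a : MForm ℕ) :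
      GLPthm ((MForm.diam m a).imp (MForm.box n (MForm.diam m a)))
  | mp {a b : MForm ℕ} : GLPthm (a.imp b) → GLPthm a → GLPthm b
  | nec (n : ℕ) {a : MForm ℕ} : GLPthm a → GLPthm (MForm.box n a)
  | subst (σ : ℕ → MForm ℕ) {a : MForm ℕ} : GLPthm a → GLPthm (a.substP σ)

/- ### Frame classes for the standard modal logics -/

def FK : Set (Frame Unit) := Set.univ
def FK4 : Set (Frame Unit) := {F | Transitive (F.R ())}
def FS4 : Set (Frame Unit) := {F | Reflexive (F.R ()) ∧ Transitive (F.R ())}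
def FKD45 : Set (Frame Unit) :=
  {F | (∀ w, ∃ v, F.R () w v) ∧ Transitive (F.R ()) ∧
    (∀ w v u, F.R () w v → F.R () w u → F.R () v u)}
def FS5 : Set (Frame Unit) := {F | Equivalence (F.R ())}
def FGL : Set (Frame Unit) :=
  {F | Transitive (F.R ()) ∧ ¬ ∃ f : ℕ → F.World, ∀ k, F.R () (f k) (f (k + 1))}


namespace EvalG

variable {Λ W : Type}

/-- Stages of the least fixed point. -/
def apx (F : Set W → Set W) (o : Ordinal.{0}) : Set W :=
  {v | ∃ b, ∃ _ : b < o, v ∈ F (apx F b)}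
termination_by o

lemma mem_apx (F : Set W → Set W) (o : Ordinal.{0}) (v : W) :
    v ∈ apx F o ↔ ∃ b, b < o ∧ v ∈ F (apx F b) := by
  rw [apx]; simp

lemma apx_eq (F : Set W →o Set W) (o : Ordinal.{0}) :
    apx F o = OrdinalApprox.lfpApprox F ⊥ o := by
  induction o using WellFoundedLT.induction with
  | ind o ih =>
    ext v
    rw [mem_apx, OrdinalApprox.lfpApprox]
    simp only [bot_sup_eq, Set.iSup_eq_iUnion, Set.mem_iUnion, exists_prop]
    constructor
    · rintro ⟨b, hb, h⟩
      exact ⟨b, hb, by rwa [← ih b hb]⟩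
    · rintro ⟨b, hb, h⟩
      exact ⟨b, hb, by rwa [ih b hb]⟩

lemma exists_apx (F : Set W → Set W) (hF : Monotone F) (v : W)
    (hv : v ∈ sInf {A : Set W | F A ⊆ A}) : ∃ o, v ∈ apx F o := by
  let G : Set W →o Set W := ⟨F, hF⟩
  have h : G.lfp = sInf {A : Set W | F A ⊆ A} := rfl
  rw [← h, ← OrdinalApprox.lfpApprox_ord_eq_lfp, ← apx_eq] at hv
  exact ⟨_, hv⟩

/-- Fixed-point formulas: `true` for μ, `false` for ν. -/
def mkfix : Bool → ℕ → MuForm Λ → MuForm Λ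
  | true, X, a => .mu X a
  | false, X, a => .nu X a

def sz : MuForm Λ → ℕ
  | .prop _ => 1
  | .nprop _ => 1
  | .var _ => 1
  | .and a b => sz a + sz b + 1
  | .or a b => sz a + sz b + 1
  | .box _ a => sz a + 1
  | .dia _ a => sz a + 1
  | .mu _ a => sz a + 1
  | .nu _ a => sz a + 1

lemma self_mem (ψ : MuForm Λ) : ψ ∈ ψ.subfs := by
  cases ψ <;> simp [MuForm.subfs]

lemma sub_trans {χ ψ : MuForm Λ} (θ : MuForm Λ) (h : χ ∈ ψ.subfs) (h2 : ψ ∈ θ.subfs) :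
    χ ∈ θ.subfs := by
  induction θ with
  | prop _ | nprop _ | var _ =>
    simp only [MuForm.subfs, List.mem_singleton] at h2; subst h2; exact h
  | and a b iha ihb | or a b iha ihb =>
    simp only [MuForm.subfs, List.mem_cons, List.mem_append] at h2
    rcases h2 with rfl | h2 | h2
    · exact h
    · simp [MuForm.subfs, iha h2]
    · simp [MuForm.subfs, ihb h2]
  | box _ a iha | dia _ a iha | mu _ a iha | nu _ a iha =>
    simp only [MuForm.subfs, List.mem_cons] at h2
    rcases h2 with rfl | h2
    · exact h
    · simp [MuForm.subfs, iha h2]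

lemma sub_sz {χ : MuForm Λ} (θ : MuForm Λ) (h2 : χ ∈ θ.subfs) : χ = θ ∨ sz χ < sz θ := by
  induction θ with
  | prop _ | nprop _ | var _ =>
    simp only [MuForm.subfs, List.mem_singleton] at h2; exact Or.inl h2
  | and a b iha ihb | or a b iha ihb =>
    simp only [MuForm.subfs, List.mem_cons, List.mem_append] at h2
    rcases h2 with rfl | h2 | h2
    · exact Or.inl rfl
    · right; rcases iha h2 with rfl | h <;> simp only [sz] <;> omega
    · right; rcases ihb h2 with rfl | h <;> simp only [sz] <;> omega
  | box _ a iha | dia _ a iha | mu _ a iha | nu _ a iha =>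
    simp only [MuForm.subfs, List.mem_cons] at h2
    rcases h2 with rfl | h2
    · exact Or.inl rfl
    · right; rcases iha h2 with rfl | h <;> simp only [sz] <;> omega

lemma bnd_pos {b : Bool} {X : ℕ} {c : MuForm Λ} (θ : MuForm Λ)
    (h : mkfix b X c ∈ θ.subfs) : 1 ≤ θ.bndCnt X := by
  induction θ with
  | prop _ | nprop _ | var _ =>
    cases b <;> simp [MuForm.subfs, mkfix] at h
  | and a b' iha ihb | or a b' iha ihb =>
    simp only [MuForm.subfs, List.mem_cons, List.mem_append] at h
    simp only [MuForm.bndCnt]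
    rcases h with h | h | h
    · cases b <;> simp [mkfix] at h
    · have := iha h; omega
    · have := ihb h; omega
  | box _ a iha | dia _ a iha =>
    simp only [MuForm.subfs, List.mem_cons] at h
    simp only [MuForm.bndCnt]
    rcases h with h | h
    · cases b <;> simp [mkfix] at h
    · exact iha h
  | mu Y a iha | nu Y a iha =>
    simp only [MuForm.subfs, List.mem_cons] at h
    simp only [MuForm.bndCnt]
    rcases h with h | h
    · cases b <;> simp [mkfix] at h
      simp [h.1]
    · have := iha h; omega

lemma bnd_uniq {b b' : Bool} {X : ℕ} {c c' : MuForm Λ} (θ : MuForm Λ)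
    (hc : θ.bndCnt X ≤ 1)
    (h : mkfix b X c ∈ θ.subfs) (h' : mkfix b' X c' ∈ θ.subfs) :
    mkfix b X c = mkfix b' X c' := by
  induction θ with
  | prop _ | nprop _ | var _ =>
    cases b <;> simp [MuForm.subfs, mkfix] at h
  | and a d iha ihb | or a d iha ihb =>
    simp only [MuForm.subfs, List.mem_cons, List.mem_append] at h h'
    simp only [MuForm.bndCnt] at hc
    rcases h with h | h | h
    · cases b <;> simp [mkfix] at h
    · rcases h' with h' | h' | h'
      · cases b' <;> simp [mkfix] at h'
      · exact iha (by omega) h h'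
      · have := bnd_pos _ h
        have := bnd_pos _ h'
        omega
    · rcases h' with h' | h' | h'
      · cases b' <;> simp [mkfix] at h'
      · have := bnd_pos _ h
        have := bnd_pos _ h'
        omega
      · exact ihb (by omega) h h'
  | box _ a iha | dia _ a iha =>
    simp only [MuForm.subfs, List.mem_cons] at h h'
    simp only [MuForm.bndCnt] at hc
    rcases h with h | h
    · cases b <;> simp [mkfix] at h
    · rcases h' with h' | h'
      · cases b' <;> simp [mkfix] at h'
      · exact iha hc h h'
  | mu Y a iha | nu Y a iha =>
    simp only [MuForm.subfs, List.mem_cons] at h h'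
    simp only [MuForm.bndCnt] at hc
    rcases h with h | h
    · rcases h' with h' | h'
      · rw [h, h']
      · have hp := bnd_pos _ h'
        have : Y = X := by cases b <;> simp [mkfix] at h; exact h.1.symm
        rw [if_pos this] at hc; omega
    · rcases h' with h' | h'
      · have hp := bnd_pos _ h
        have : Y = X := by cases b' <;> simp [mkfix] at h'; exact h'.1.symm
        rw [if_pos this] at hc; omega
      · exact iha (by omega) h h'

/-- Neither a fixed-point formula nor a variable. -/
def IsFix (ψ : MuForm Λ) : Prop := ∃ b X a, ψ = mkfix b X a
def IsVar (ψ : MuForm Λ) : Prop := ∃ X, ψ = .var X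

lemma var_not_fix (X : ℕ) : ¬ IsFix (MuForm.var X : MuForm Λ) := by
  rintro ⟨b, Y, a, h⟩; cases b <;> simp [mkfix] at h

lemma fix_not_var (b : Bool) (X : ℕ) (a : MuForm Λ) : ¬ IsVar (mkfix b X a) := by
  rintro ⟨Y, h⟩; cases b <;> simp [mkfix] at h

lemma move_sub (M : KModel Λ W) (φ ψ χ : MuForm Λ) (v u : W) (hf : ¬ IsFix ψ) (hv : ¬ IsVar ψ)
    (h : evalMove M φ (ψ, v) (χ, u)) :
    χ ∈ ψ.subfs ∧ sz χ < sz ψ ∧ χ.freeVars ⊆ ψ.freeVars := by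
  cases ψ with
  | prop _ => exact h.elim
  | nprop _ => exact h.elim
  | var X => exact (hv ⟨X, rfl⟩).elim
  | and a b | or a b =>
    simp only [evalMove, Prod.mk.injEq] at h
    rcases h with ⟨rfl, rfl⟩ | ⟨rfl, rfl⟩
    · exact ⟨by simp [MuForm.subfs, self_mem], by simp only [sz]; omega,
        by simp [MuForm.freeVars]⟩
    · exact ⟨by simp [MuForm.subfs, self_mem], by simp only [sz]; omega,
        by simp [MuForm.freeVars]⟩
  | box i a | dia i a =>
    simp only [evalMove, Prod.mk.injEq] at h
    obtain ⟨_, _, rfl, _⟩ := h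
    exact ⟨by simp [MuForm.subfs, self_mem], by simp only [sz]; omega,
        by simp [MuForm.freeVars]⟩
  | mu X a => exact (hf ⟨true, X, a, rfl⟩).elim
  | nu X a => exact (hf ⟨false, X, a, rfl⟩).elim

lemma move_fix (M : KModel Λ W) (φ : MuForm Λ) (b : Bool) (X : ℕ) (a : MuForm Λ) (v : W)
    (y : MuForm Λ × W) : evalMove M φ (mkfix b X a, v) y ↔ y = (a, v) := by
  cases b <;> rfl

lemma move_var (M : KModel Λ W) (φ : MuForm Λ) (b : Bool) (X : ℕ) (a : MuForm Λ) (v : W)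
    (hc : φ.bndCnt X ≤ 1) (h : mkfix b X a ∈ φ.subfs)
    (y : MuForm Λ × W) : evalMove M φ (.var X, v) y ↔ y = (mkfix b X a, v) := by
  constructor
  · rintro ⟨c, ⟨h1, rfl⟩ | ⟨h1, rfl⟩⟩
    · rw [bnd_uniq φ hc h (show mkfix true X c ∈ φ.subfs from h1)]; rfl
    · rw [bnd_uniq φ hc h (show mkfix false X c ∈ φ.subfs from h1)]; rfl
  · rintro rfl
    cases b
    · exact ⟨a, Or.inr ⟨h, rfl⟩⟩
    · exact ⟨a, Or.inl ⟨h, rfl⟩⟩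

/- ### Strategies from invariants -/

lemma histN_succ {Pos : Type} (p : ℕ → Pos) (n : ℕ) :
    histN p (n + 1) = p (n + 1) :: histN p n := by
  simp [histN, List.range_succ]

lemma histN_zero {Pos : Type} (p : ℕ → Pos) : histN p 0 = [p 0] := by
  simp [histN, List.range_succ]

lemma histN_cons {Pos : Type} (p : ℕ → Pos) (n : ℕ) : ∃ l, histN p n = p n :: l := by
  cases n with
  | zero => exact ⟨[], histN_zero p⟩
  | succ n => exact ⟨_, histN_succ p n⟩

open Classical in
/-- The memory after a history. -/
noncomputable def stOf {Pos S : Type*} (s0 : S) (T : Pos → S → Pos → S → Prop) : List Pos → S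
  | [] => s0
  | [_] => s0
  | y :: x :: l =>
    if h : ∃ s', T x (stOf s0 T (x :: l)) y s' then h.choose else s0

open Classical in
lemma wins_of_inv {Pos : Type} {S : Type*} (G : Game Pos) (own : Pos → Prop)
    (winO : (ℕ → Pos) → Prop) (s0 : S) (Inv : Pos → S → Prop) (T : Pos → S → Pos → S → Prop)
    (h0 : Inv G.init s0)
    (hT : ∀ x s y s', T x s y s' → Inv y s')
    (hown : ∀ x s, Inv x s → own x → ∃ y s', G.move x y ∧ T x s y s')
    (hopp : ∀ x s y, Inv x s → ¬ own x → G.move x y → ∃ s', T x s y s')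
    (hwin : ∀ (p : ℕ → Pos) (t : ℕ → S), (∀ n, Inv (p n) (t n)) →
      (∀ n, T (p n) (t n) (p (n + 1)) (t (n + 1))) → winO p) :
    G.WinsFor own winO := by
  let st := stOf s0 T
  let σ : List Pos → Pos := fun l => match l with
    | [] => G.init
    | x :: l => if h : ∃ y s', G.move x y ∧ T x (st (x :: l)) y s' then h.choose else x
  have hst : ∀ x y l, (∃ s', T x (st (x :: l)) y s') →
      T x (st (x :: l)) y (st (y :: x :: l)) := by
    intro x y l h
    have : st (y :: x :: l) = h.choose := by
      show stOf s0 T (y :: x :: l) = _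
      rw [stOf, dif_pos h]
    rw [this]; exact h.choose_spec
  have hσ : ∀ x l, Inv x (st (x :: l)) → own x →
      G.move x (σ (x :: l)) ∧ ∃ s', T x (st (x :: l)) (σ (x :: l)) s' := by
    intro x l hi ho
    have h := hown x _ hi ho
    have e : σ (x :: l) = h.choose := by
      show (if h : ∃ y s', G.move x y ∧ T x (st (x :: l)) y s' then h.choose else x) = _
      rw [dif_pos h]
    rw [e]
    obtain ⟨s', h1, h2⟩ := h.choose_spec
    exact ⟨h1, s', h2⟩
  refine ⟨σ, ?_, ?_⟩
  · have key : ∀ l, G.Hist own σ l → ∀ x l', l = x :: l' → Inv x (st l) := by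
      intro l h
      induction h with
      | init =>
        rintro x l' h
        cases h
        exact h0
      | @smove l x hh ho hm ih =>
        rintro y l' h
        cases h
        exact hT _ _ _ _ (hst _ _ _ (hσ x l (ih _ _ rfl) ho).2)
      | @omove l x y hh ho hm ih =>
        rintro y l' h
        cases h
        exact hT _ _ _ _ (hst _ _ _ (hopp x _ _ (ih _ _ rfl) ho hm))
    intro l x h ho
    exact (hσ x l (key _ h _ _ rfl) ho).1
  · intro p hp0 hpm hps
    have hstep : ∀ n, Inv (p n) (st (histN p n)) →
        T (p n) (st (histN p n)) (p (n + 1)) (st (histN p (n + 1))) := by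
      intro n hi
      rw [histN_succ]
      obtain ⟨l, hl⟩ := histN_cons p n
      have hs := hps n
      rw [hl] at hi hs ⊢
      apply hst
      by_cases ho : own (p n)
      · rw [hs ho]; exact (hσ _ _ hi ho).2
      · exact hopp _ _ _ hi ho (hpm n)
    have hinv : ∀ n, Inv (p n) (st (histN p n)) := by
      intro n
      induction n with
      | zero => rw [histN_zero, hp0]; exact h0
      | succ n ih => exact hT _ _ _ _ (hstep n ih)
    exact hwin p (fun n => st (histN p n)) hinv (fun n => hstep n (hinv n))

/-- Both players cannot win. -/
lemma not_both {Pos : Type} (G : Game Pos) (h1 : G.VWins) (h2 : G.RWins) : False := by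
  classical
  obtain ⟨σ, hσ, hσw⟩ := h1
  obtain ⟨τ, hτ, hτw⟩ := h2
  let nx : List Pos → Pos := fun l => match l with
    | [] => G.init
    | x :: l => if G.ownV x then σ (x :: l) else τ (x :: l)
  let H : ℕ → List Pos := fun n => Nat.rec [G.init] (fun _ l => nx l :: l) n
  let p : ℕ → Pos := fun n => match H n with
    | [] => G.init
    | x :: _ => x
  have hHp : ∀ n, H (n + 1) = p (n + 1) :: H n := fun n => rfl
  have hH : ∀ n, histN p n = H n := by
    intro n
    induction n with
    | zero => rw [histN_zero]; rfl
    | succ n ih => rw [histN_succ, ih, hHp]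
  have hp : ∀ n, p (n + 1) = nx (H n) := fun n => rfl
  have key : ∀ n, G.Hist G.ownV σ (H n) ∧ G.Hist (fun x => ¬ G.ownV x) τ (H n) := by
    intro n
    induction n with
    | zero => exact ⟨.init, .init⟩
    | succ n ih =>
      obtain ⟨l, hl⟩ := histN_cons p n
      rw [hH] at hl
      rw [hHp, hp]
      rw [hl] at ih ⊢
      by_cases ho : G.ownV (p n)
      · have : nx (p n :: l) = σ (p n :: l) := if_pos ho
        rw [this]
        exact ⟨.smove ih.1 ho (hσ _ _ ih.1 ho), .omove ih.2 (not_not.2 ho) (hσ _ _ ih.1 ho)⟩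
      · have : nx (p n :: l) = τ (p n :: l) := if_neg ho
        rw [this]
        exact ⟨.omove ih.1 ho (hτ _ _ ih.2 ho), .smove ih.2 ho (hτ _ _ ih.2 ho)⟩
  have hs1 : ∀ n, G.ownV (p n) → p (n + 1) = σ (histN p n) := by
    intro n ho
    obtain ⟨l, hl⟩ := histN_cons p n
    rw [hp, ← hH, hl]; exact if_pos ho
  have hs2 : ∀ n, ¬ G.ownV (p n) → p (n + 1) = τ (histN p n) := by
    intro n ho
    obtain ⟨l, hl⟩ := histN_cons p n
    rw [hp, ← hH, hl]; exact if_neg ho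
  have hm : ∀ n, G.move (p n) (p (n + 1)) := by
    intro n
    obtain ⟨l, hl⟩ := histN_cons p n
    have hk := key n
    rw [← hH, hl] at hk
    by_cases ho : G.ownV (p n)
    · rw [hs1 n ho, hl]; exact hσ _ _ hk.1 ho
    · rw [hs2 n ho, hl]; exact hτ _ _ hk.2 ho
  exact hτw p rfl hm hs2 (hσw p rfl hm hs1)

/-- A stack entry. -/
structure Ent (Λ : Type) : Type 1 where
  b : Bool
  X : ℕ
  a : MuForm Λ
  o : Ordinal.{0}

def Ent.form (e : Ent Λ) : MuForm Λ := mkfix e.b e.X e.a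

def Ent.set (e : Ent Λ) (o : Ordinal.{0}) : Ent Λ := ⟨e.b, e.X, e.a, o⟩

/-- Semantics from the point of view of the player for which `mkfix p` is bad. -/
structure SemOK (M : KModel Λ W) (φ : MuForm Λ) (p : Bool) (own : MuForm Λ × W → Prop)
    (sp : (ℕ → Set W) → MuForm Λ → Set W) : Prop where
  mono : ∀ (ψ : MuForm Λ) (e e' : ℕ → Set W), (∀ x, e x ⊆ e' x) → sp e ψ ⊆ sp e' ψ
  var : ∀ e x, sp e (.var x) = e x
  bad : ∀ e X a, sp e (mkfix p X a) = sInf {A : Set W | sp (Function.update e X A) a ⊆ A}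
  good : ∀ e X a, sp e (mkfix (!p) X a) ⊆ sp (Function.update e X (sp e (mkfix (!p) X a))) a
  hown : ∀ e ψ v, ¬ IsFix ψ → ¬ IsVar ψ → v ∈ sp e ψ → own (ψ, v) →
    ∃ χ u, evalMove M φ (ψ, v) (χ, u) ∧ u ∈ sp e χ
  hopp : ∀ e ψ v, ¬ IsFix ψ → ¬ IsVar ψ → v ∈ sp e ψ → ¬ own (ψ, v) →
    ∀ χ u, evalMove M φ (ψ, v) (χ, u) → u ∈ sp e χ

open Classical in
/-- The environment of a stack. -/
noncomputable def envS (sp : (ℕ → Set W) → MuForm Λ → Set W) (p : Bool) (env0 : ℕ → Set W) :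
    List (Ent Λ) → ℕ → Set W
  | [] => env0
  | e :: Γ => Function.update (envS sp p env0 Γ) e.X
      (if e.b = p then apx (fun A => sp (Function.update (envS sp p env0 Γ) e.X A) e.a) e.o
        else sp (envS sp p env0 Γ) e.form)

def bnd (Γ : List (Ent Λ)) : Set ℕ := {x | ∃ e ∈ Γ, e.X = x}

/-- Location invariant with slack `k`. -/
def PosOK (φ : MuForm Λ) (k : ℕ) (ψ : MuForm Λ) (Γ : List (Ent Λ)) : Prop :=
  ψ ∈ φ.subfs ∧ ψ.freeVars ⊆ bnd Γ ∧ (∀ e ∈ Γ, ψ ∈ e.form.subfs) ∧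
    Γ.length + sz ψ ≤ sz φ + k

def StkOK (φ : MuForm Λ) : List (Ent Λ) → Prop
  | [] => True
  | e :: Γ => PosOK φ 1 e.form (e :: Γ) ∧ StkOK φ Γ

lemma StkOK.suffix {φ : MuForm Λ} (Γ1 Γ2 : List (Ent Λ)) (h : StkOK φ (Γ1 ++ Γ2)) :
    StkOK φ Γ2 := by
  induction Γ1 with
  | nil => exact h
  | cons e Γ ih => exact ih h.2

def Inv (φ : MuForm Λ) (sp : (ℕ → Set W) → MuForm Λ → Set W) (p : Bool) (env0 : ℕ → Set W)
    (x : MuForm Λ × W) (Γ : List (Ent Λ)) : Prop :=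
  StkOK φ Γ ∧ PosOK φ 1 x.1 Γ ∧
  ((¬ IsFix x.1 ∧ x.2 ∈ sp (envS sp p env0 Γ) x.1) ∨
    ∃ e Γ2, Γ = e :: Γ2 ∧ x.1 = e.form ∧ x.2 ∈ envS sp p env0 Γ e.X)

def Push (Γ Γ' : List (Ent Λ)) : Prop := Γ' = Γ ∨ ∃ e, Γ' = e :: Γ

def IsC (ψ ψ' : MuForm Λ) (Γ Γ' : List (Ent Λ)) : Prop :=
  IsVar ψ ∧ ∃ Γ1 e Γ2, Γ = Γ1 ++ Γ' ∧ Γ' = e :: Γ2 ∧ ψ' = e.form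

/-- Steps of the stack. -/
def Step (p : Bool) (ψ ψ' : MuForm Λ) (Γ Γ' : List (Ent Λ)) : Prop :=
  (¬ IsFix ψ ∧ sz ψ' < sz ψ ∧ Push Γ Γ') ∨
  (∃ e Γ2 o, Γ = e :: Γ2 ∧ ψ = e.form ∧ sz ψ' < sz ψ ∧ o ≤ e.o ∧ (e.b = p → o < e.o) ∧
    Push (e.set o :: Γ2) Γ') ∨
  IsC ψ ψ' Γ Γ'

section core

variable {M : KModel Λ W} {φ : MuForm Λ} {p : Bool} {own : MuForm Λ × W → Prop}
  {sp : (ℕ → Set W) → MuForm Λ → Set W} {env0 : ℕ → Set W}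

lemma enter (H : SemOK M φ p own sp) {ψ : MuForm Λ} {v : W} {Γ : List (Ent Λ)}
    (h1 : StkOK φ Γ) (h2 : PosOK φ 0 ψ Γ) (h3 : v ∈ sp (envS sp p env0 Γ) ψ) :
    ∃ Γ', Inv φ sp p env0 (ψ, v) Γ' ∧ Push Γ Γ' := by
  obtain ⟨ha, hb, hc, hd⟩ := h2
  by_cases hf : IsFix ψ
  · obtain ⟨b, X, a, rfl⟩ := hf
    have hex : ∃ o, v ∈ envS sp p env0 ((⟨b, X, a, o⟩ : Ent Λ) :: Γ) X := by
      simp only [envS, Function.update_self]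
      by_cases hbp : b = p
      · simp only [hbp, if_true]
        rw [hbp, H.bad] at h3
        apply exists_apx _ _ _ h3
        intro A B hAB
        apply H.mono
        intro x
        by_cases hx : x = X
        · subst hx; simpa using hAB
        · simp [Function.update_of_ne hx]
      · simp only [hbp, if_false]
        exact ⟨0, h3⟩
    obtain ⟨o, ho⟩ := hex
    have hP : PosOK φ 1 (mkfix b X a) ((⟨b, X, a, o⟩ : Ent Λ) :: Γ) := by
      refine ⟨ha, ?_, ?_, ?_⟩
      · intro x hx
        obtain ⟨e, he, hex⟩ := hb hx
        exact ⟨e, List.mem_cons_of_mem _ he, hex⟩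
      · intro e he
        rcases List.mem_cons.1 he with rfl | he
        · exact self_mem _
        · exact hc e he
      · simp only [List.length_cons]; omega
    have hS' : StkOK φ ((⟨b, X, a, o⟩ : Ent Λ) :: Γ) := ⟨hP, h1⟩
    exact ⟨_, ⟨hS', hP, Or.inr ⟨_, _, rfl, rfl, ho⟩⟩, Or.inr ⟨_, rfl⟩⟩
  · exact ⟨Γ, ⟨h1, ⟨ha, hb, hc, by show Γ.length + sz ψ ≤ sz φ + 1; omega⟩, Or.inl ⟨hf, h3⟩⟩, Or.inl rfl⟩

lemma lookup {Γ : List (Ent Λ)} {X : ℕ} (h : X ∈ bnd Γ) :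
    ∃ Γ1 e Γ2, Γ = Γ1 ++ e :: Γ2 ∧ e.X = X ∧
      envS sp p env0 Γ X = envS sp p env0 (e :: Γ2) X := by
  induction Γ with
  | nil => obtain ⟨e, he, _⟩ := h; simp at he
  | cons e Γ ih =>
    by_cases hx : e.X = X
    · exact ⟨[], e, Γ, rfl, hx, rfl⟩
    · have : X ∈ bnd Γ := by
        obtain ⟨e', he', hx'⟩ := h
        rcases List.mem_cons.1 he' with rfl | he'
        · exact (hx hx').elim
        · exact ⟨e', he', hx'⟩
      obtain ⟨Γ1, e1, Γ2, rfl, h2, h3⟩ := ih this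
      refine ⟨e :: Γ1, e1, Γ2, rfl, h2, ?_⟩
      rw [← h3, envS, Function.update_of_ne (Ne.symm hx)]

/-- One step for positions with determined moves. -/
lemma step_fix (H : SemOK M φ p own sp) {ψ : MuForm Λ} {v : W} {Γ : List (Ent Λ)}
    (hb : ∀ X, φ.bndCnt X ≤ 1)
    (hI : Inv φ sp p env0 (ψ, v) Γ) (hd : IsFix ψ ∨ IsVar ψ) :
    ∃ y Γ', (∀ z, evalMove M φ (ψ, v) z ↔ z = y) ∧ Inv φ sp p env0 y Γ' ∧ Step p ψ y.1 Γ Γ' := by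
  obtain ⟨hS, hP, hI⟩ := hI
  rcases hd with hd | ⟨X, rfl⟩
  · rcases hI with ⟨hn, _⟩ | ⟨e, Γ2, rfl, he, hv⟩
    · exact (hn hd).elim
    simp only at he hv
    subst he
    have hex : ∃ o, o ≤ e.o ∧ (e.b = p → o < e.o) ∧ v ∈ sp (envS sp p env0 (e.set o :: Γ2)) e.a := by
      simp only [envS, Function.update_self] at hv
      by_cases hbp : e.b = p
      · rw [if_pos hbp, mem_apx] at hv
        obtain ⟨o, ho, hv⟩ := hv
        refine ⟨o, ho.le, fun _ => ho, ?_⟩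
        rw [envS, if_pos (show (e.set o).b = p from hbp)]
        exact hv
      · rw [if_neg hbp] at hv
        refine ⟨e.o, le_rfl, fun h => (hbp h).elim, ?_⟩
        rw [envS, if_neg (show ¬ (e.set e.o).b = p from hbp)]
        have hb' : e.b = !p := by cases h : e.b <;> cases h' : p <;> simp_all
        have := H.good (envS sp p env0 Γ2) e.X e.a
        rw [← hb'] at this
        exact this hv
    obtain ⟨o, ho1, ho2, hv⟩ := hex
    have hPe : PosOK φ 1 e.form (e.set o :: Γ2) := by
      obtain ⟨h1, h2, h3, h4⟩ := hP
      refine ⟨h1, ?_, ?_, h4⟩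
      · intro x hx
        obtain ⟨e', he', hx'⟩ := h2 hx
        rcases List.mem_cons.1 he' with rfl | he'
        · exact ⟨_, List.mem_cons_self, hx'⟩
        · exact ⟨_, List.mem_cons_of_mem _ he', hx'⟩
      · intro e' he'
        rcases List.mem_cons.1 he' with rfl | he'
        · exact self_mem _
        · exact h3 e' (List.mem_cons_of_mem _ he')
    have hS' : StkOK φ (e.set o :: Γ2) := ⟨hPe, hS.2⟩
    have hsub : e.a ∈ e.form.subfs := by
      unfold Ent.form; cases e.b <;> simp [mkfix, MuForm.subfs, self_mem]
    have hsz : sz e.form = sz e.a + 1 := by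
      unfold Ent.form; cases e.b <;> simp [mkfix, sz]
    have hfv : ∀ x ∈ e.a.freeVars, x = e.X ∨ x ∈ e.form.freeVars := by
      intro x hx
      unfold Ent.form; cases e.b <;> simp [mkfix, MuForm.freeVars, hx] <;> tauto
    have hPa : PosOK φ 0 e.a (e.set o :: Γ2) := by
      obtain ⟨h1, h2, h3, h4⟩ := hPe
      refine ⟨sub_trans _ hsub h1, ?_, fun e' he' => sub_trans _ hsub (h3 e' he'), by omega⟩
      intro x hx
      rcases hfv x hx with rfl | hx
      · exact ⟨_, List.mem_cons_self, rfl⟩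
      · exact h2 hx
    obtain ⟨Γ', hI', hpush⟩ := enter H hS' hPa hv
    exact ⟨(e.a, v), Γ', fun z => move_fix M φ e.b e.X e.a v z, hI',
      Or.inr (Or.inl ⟨e, Γ2, o, rfl, rfl, by simp only; omega, ho1, ho2, hpush⟩)⟩
  · rcases hI with ⟨_, hv⟩ | ⟨e, Γ2, rfl, he, hv⟩
    · simp only [H.var] at hv
      have hX : X ∈ bnd Γ := hP.2.1 (by simp [MuForm.freeVars])
      obtain ⟨Γ1, e, Γ2, rfl, rfl, he⟩ := lookup (sp := sp) (p := p) (env0 := env0) hX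
      rw [he] at hv
      have hS2 := StkOK.suffix _ _ hS
      exact ⟨(e.form, v), e :: Γ2, fun z => move_var M φ e.b e.X e.a v (hb _) hS2.1.1 z,
        ⟨hS2, hS2.1, Or.inr ⟨e, Γ2, rfl, rfl, hv⟩⟩,
        Or.inr (Or.inr ⟨⟨_, rfl⟩, Γ1, e, Γ2, rfl, rfl, rfl⟩)⟩
    · exact (fix_not_var e.b e.X e.a ⟨X, he.symm⟩).elim

lemma step_sub (H : SemOK M φ p own sp) {ψ χ : MuForm Λ} {v u : W} {Γ : List (Ent Λ)}
    (hI : Inv φ sp p env0 (ψ, v) Γ) (hf : ¬ IsFix ψ) (hv : ¬ IsVar ψ)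
    (hm : evalMove M φ (ψ, v) (χ, u)) (hu : u ∈ sp (envS sp p env0 Γ) χ) :
    ∃ Γ', Inv φ sp p env0 (χ, u) Γ' ∧ Step p ψ χ Γ Γ' := by
  obtain ⟨h1, h2, h3⟩ := move_sub M φ ψ χ v u hf hv hm
  obtain ⟨hS, ⟨p1, p2, p3, p4⟩, -⟩ := hI
  simp only at p1 p2 p3 p4
  obtain ⟨Γ', hI', hpush⟩ := enter H (ψ := χ) hS ⟨sub_trans _ h1 p1, h3.trans p2,
    fun e he => sub_trans _ h1 (p3 e he), by omega⟩ hu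
  exact ⟨Γ', hI', Or.inl ⟨hf, h2, hpush⟩⟩

/-- The infinite plays. -/
lemma inf_play (q : ℕ → MuForm Λ × W) (t : ℕ → List (Ent Λ))
    (hI : ∀ n, Inv φ sp p env0 (q n) (t n))
    (hS : ∀ n, Step p (q n).1 (q (n + 1)).1 (t n) (t (n + 1))) :
    ∃ X a, InfOccF q (mkfix (!p) X a) ∧ ∀ χ, InfOccF q χ → χ ∈ (mkfix (!p) X a).subfs := by
  let C : ℕ → Prop := fun n => IsC (q n).1 (q (n + 1)).1 (t n) (t (n + 1))
  have hC : ∀ N, ∃ n, N ≤ n ∧ C n := by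
    intro N
    by_contra hcon
    push Not at hcon
    have hdec : ∀ k, sz (q (N + k)).1 + k ≤ sz (q N).1 := by
      intro k
      induction k with
      | zero => simp
      | succ k ih =>
        have : sz (q (N + k + 1)).1 < sz (q (N + k)).1 := by
          rcases hS (N + k) with h | ⟨e, Γ2, o, _, _, h, _⟩ | h
          · exact h.2.1
          · exact h
          · exact (hcon _ (by omega) h).elim
        have e : N + (k + 1) = N + k + 1 := by omega
        rw [e]; omega
    have := hdec (sz (q N).1 + 1)
    omega
  have hex : ∃ L, ∀ N, ∃ n, N ≤ n ∧ C n ∧ (t (n + 1)).length ≤ L := by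
    refine ⟨sz φ + 1, fun N => ?_⟩
    obtain ⟨n, hn, hc⟩ := hC N
    have := (hI (n + 1)).2.1.2.2.2
    exact ⟨n, hn, hc, by omega⟩
  classical
  let L := Nat.find hex
  have hL : ∀ N, ∃ n, N ≤ n ∧ C n ∧ (t (n + 1)).length ≤ L := Nat.find_spec hex
  have hmin : ∃ N, ∀ n, N ≤ n → C n → L ≤ (t (n + 1)).length := by
    by_cases h0 : L = 0
    · exact ⟨0, fun n _ _ => by omega⟩
    · have := Nat.find_min hex (m := L - 1) (by show L - 1 < L; omega)
      push Not at this
      obtain ⟨N, hN⟩ := this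
      exact ⟨N, fun n h1 h2 => by have := hN n h1 h2; omega⟩
  obtain ⟨N, hN⟩ := hmin
  obtain ⟨n0, hn0, hc0, hl0⟩ := hL N
  obtain ⟨-, -, e0, Γ0, -, ht0, -⟩ := id hc0
  have hlen : Γ0.length + 1 = L := by
    have := hN n0 hn0 hc0
    rw [ht0, List.length_cons] at this hl0
    omega
  let At : ℕ → Ordinal.{0} → Prop := fun n o => ∃ Δ, t n = Δ ++ e0.set o :: Γ0
  have hstep : ∀ n o, n0 + 1 ≤ n → At n o → ∃ o', o' ≤ o ∧ At (n + 1) o' ∧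
      ((t n).length = L → IsFix (q n).1 → e0.b = p → o' < o) := by
    rintro n o hn ⟨Δ, hΔ⟩
    rcases hS n with ⟨h, _, hpush⟩ | ⟨e, Γ2, o1, h1, h2, -, h3, h4, hpush⟩ | hc
    · refine ⟨o, le_rfl, ?_, fun _ h' => (h h').elim⟩
      rcases hpush with hp | ⟨e, hp⟩
      · exact ⟨Δ, by rw [hp, hΔ]⟩
      · exact ⟨e :: Δ, by rw [hp, hΔ]; rfl⟩
    · rw [hΔ] at h1
      cases Δ with
      | nil =>
        simp only [List.nil_append, List.cons.injEq] at h1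
        obtain ⟨rfl, rfl⟩ := h1
        refine ⟨o1, h3, ?_, fun _ _ => h4⟩
        rcases hpush with hp | ⟨e, hp⟩
        · exact ⟨[], hp⟩
        · exact ⟨[e], hp⟩
      | cons d Δ =>
        simp only [List.cons_append, List.cons.injEq] at h1
        obtain ⟨rfl, rfl⟩ := h1
        refine ⟨o, le_rfl, ?_, fun h => ?_⟩
        · rcases hpush with hp | ⟨e, hp⟩
          · exact ⟨d.set o1 :: Δ, hp⟩
          · exact ⟨e :: d.set o1 :: Δ, hp⟩
        · rw [hΔ] at h
          simp at h; omega
    · have hge := hN n (by omega) hc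
      obtain ⟨⟨X, hX⟩, Γ1, e, Γ2, h1, h2, h3⟩ := hc
      refine ⟨o, le_rfl, ?_, fun _ h' => (var_not_fix X (hX ▸ h')).elim⟩
      rw [hΔ] at h1
      have hsuf1 : e0.set o :: Γ0 <:+ Δ ++ e0.set o :: Γ0 := ⟨Δ, rfl⟩
      have hsuf2 : t (n + 1) <:+ Δ ++ e0.set o :: Γ0 := ⟨Γ1, h1.symm⟩
      obtain ⟨D, hD⟩ := List.suffix_of_suffix_length_le hsuf1 hsuf2
        (by rw [List.length_cons]; omega)
      exact ⟨D, hD.symm⟩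
  have hne : ∃ o, ∃ n, n0 + 1 ≤ n ∧ At n o := ⟨e0.o, n0 + 1, le_rfl, [], ht0⟩
  obtain ⟨o, ⟨n1, hn1, hAt1⟩, homin⟩ := WellFounded.has_min (wellFounded_lt (α := Ordinal.{0}))
    {o | ∃ n, n0 + 1 ≤ n ∧ At n o} hne
  have hAt : ∀ n, n1 ≤ n → At n o := by
    intro n hn
    induction n, hn using Nat.le_induction with
    | base => exact hAt1
    | succ n hn ih =>
      obtain ⟨o', h1, h2, -⟩ := hstep n o (by omega) ih
      have := homin o' ⟨n + 1, by omega, h2⟩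
      have : o' = o := le_antisymm h1 (not_lt.1 this)
      rwa [this] at h2
  have hvis : ∀ N', ∃ n, N' ≤ n ∧ n1 ≤ n ∧ (t n).length = L ∧ (q n).1 = e0.form := by
    intro N'
    obtain ⟨n, hn, hc, hl⟩ := hL (max (max N N') n1)
    have hge := hN n (by omega) hc
    obtain ⟨-, Γ1, e, Γ2, h1, h2, h3⟩ := hc
    refine ⟨n + 1, by omega, by omega, by omega, ?_⟩
    obtain ⟨Δ, hΔ⟩ := hAt (n + 1) (by omega)
    have hlΔ : Δ.length = 0 := by
      rw [hΔ] at hl; simp at hl; omega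
    rw [List.length_eq_zero_iff] at hlΔ
    subst hlΔ
    rw [h2] at hΔ
    simp only [List.nil_append, List.cons.injEq] at hΔ
    rw [h3, hΔ.1]; rfl
  have hgood : e0.b ≠ p := by
    intro hb
    obtain ⟨n, -, hn, hl, hq⟩ := hvis 0
    obtain ⟨o', h1, h2, h3⟩ := hstep n o (by omega) (hAt n hn)
    exact homin o' ⟨n + 1, by omega, h2⟩ (h3 hl ⟨_, _, _, hq⟩ hb)
  have hb' : e0.b = !p := by cases h : e0.b <;> cases h' : p <;> simp_all
  refine ⟨e0.X, e0.a, ?_, ?_⟩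
  · intro N'
    obtain ⟨n, hn, -, -, hq⟩ := hvis N'
    exact ⟨n, hn, by rw [hq, Ent.form, hb']⟩
  · intro χ hχ
    obtain ⟨n, hn, rfl⟩ := hχ n1
    obtain ⟨Δ, hΔ⟩ := hAt n hn
    have := (hI n).2.1.2.2.1 (e0.set o) (by rw [hΔ]; simp)
    rw [← hb']; exact this

theorem core (H : SemOK M φ p own sp) (hφ : WellNamed φ) {w : W} (winO : (ℕ → MuForm Λ × W) → Prop)
    (hwin : ∀ q, (∃ X a, InfOccF q (mkfix (!p) X a) ∧
      ∀ χ, InfOccF q χ → χ ∈ (mkfix (!p) X a).subfs) → winO q)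
    (hw : w ∈ sp env0 φ) : (evalGame M w φ).WinsFor own winO := by
  have hb : ∀ X, φ.bndCnt X ≤ 1 := fun X => (hφ.1 X).2
  obtain ⟨Γ, hΓ, -⟩ := enter (env0 := env0) (Γ := []) H trivial
    ⟨self_mem φ, by rw [hφ.2]; exact Set.empty_subset _, by simp, by simp⟩ hw
  apply wins_of_inv (evalGame M w φ) own winO Γ (Inv φ sp p env0)
    (fun x s y s' => Inv φ sp p env0 y s' ∧ Step p x.1 y.1 s s') hΓ
  · intro x s y s' h; exact h.1
  · rintro ⟨ψ, v⟩ s hI ho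
    by_cases hd : IsFix ψ ∨ IsVar ψ
    · obtain ⟨y, Γ', h1, h2, h3⟩ := step_fix H hb hI hd
      exact ⟨y, Γ', (h1 y).2 rfl, h2, h3⟩
    · push Not at hd
      rcases hI.2.2 with ⟨_, hv⟩ | ⟨e, _, _, he, _⟩
      · obtain ⟨χ, u, hm, hu⟩ := H.hown _ _ _ hd.1 hd.2 hv ho
        obtain ⟨Γ', h⟩ := step_sub H hI hd.1 hd.2 hm hu
        exact ⟨_, Γ', hm, h⟩
      · exact (hd.1 ⟨_, _, _, he⟩).elim
  · rintro ⟨ψ, v⟩ s ⟨χ, u⟩ hI ho hm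
    by_cases hd : IsFix ψ ∨ IsVar ψ
    · obtain ⟨y, Γ', h1, h2, h3⟩ := step_fix H hb hI hd
      have := (h1 _).1 hm
      subst this
      exact ⟨Γ', h2, h3⟩
    · push Not at hd
      rcases hI.2.2 with ⟨_, hv⟩ | ⟨e, _, _, he, _⟩
      · exact step_sub H hI hd.1 hd.2 hm (H.hopp _ _ _ hd.1 hd.2 hv ho _ _ hm)
      · exact (hd.1 ⟨_, _, _, he⟩).elim
  · intro q t h1 h2
    exact hwin q (inf_play q t h1 (fun n => (h2 n).2))

end core

lemma sem_mono (M : KModel Λ W) (ψ : MuForm Λ) : ∀ (e e' : ℕ → Set W), (∀ x, e x ⊆ e' x) →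
    ψ.sem M e ⊆ ψ.sem M e' := by
  induction ψ with
  | prop _ | nprop _ => intro e e' h; exact subset_rfl
  | var x => intro e e' h; exact h x
  | and a b iha ihb => intro e e' h; exact Set.inter_subset_inter (iha _ _ h) (ihb _ _ h)
  | or a b iha ihb => intro e e' h; exact Set.union_subset_union (iha _ _ h) (ihb _ _ h)
  | box i a iha => intro e e' h w hw v hv; exact iha _ _ h (hw v hv)
  | dia i a iha => intro e e' h w ⟨v, hv, hv'⟩; exact ⟨v, hv, iha _ _ h hv'⟩
  | mu X a iha =>
    intro e e' h
    apply sInf_le_sInf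
    intro A hA
    refine (iha _ _ ?_).trans hA
    intro x
    by_cases hx : x = X
    · subst hx; simp
    · simp [Function.update_of_ne hx, h x]
  | nu X a iha =>
    intro e e' h
    apply sSup_le_sSup
    intro A hA
    refine Set.Subset.trans hA (iha _ _ ?_)
    intro x
    by_cases hx : x = X
    · subst hx; simp
    · simp [Function.update_of_ne hx, h x]

lemma upd_mono (e : ℕ → Set W) (X : ℕ) {A B : Set W} (h : A ⊆ B) (x : ℕ) :
    Function.update e X A x ⊆ Function.update e X B x := by
  by_cases hx : x = X
  · subst hx; simpa
  · simp [Function.update_of_ne hx]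

lemma upd_compl (e : ℕ → Set W) (X : ℕ) (A : Set W) :
    (fun x => (Function.update e X A x)ᶜ) = Function.update (fun x => (e x)ᶜ) X Aᶜ := by
  funext x
  by_cases hx : x = X
  · subst hx; simp
  · simp [Function.update_of_ne hx]

lemma semV (M : KModel Λ W) (φ : MuForm Λ) :
    SemOK M φ true (evalOwnV M φ) (fun e ψ => ψ.sem M e) where
  mono := sem_mono M
  var _ _ := rfl
  bad _ _ _ := rfl
  good e X a := by
    intro v hv
    obtain ⟨A, hA, hvA⟩ := hv
    refine sem_mono M a _ _ (upd_mono e X ?_) (hA hvA)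
    exact le_sSup (α := Set W) hA
  hown e ψ v hf hvr hv ho := by
    cases ψ with
    | prop _ => exact (ho hv).elim
    | nprop _ => exact (hv ho).elim
    | var X => exact (hvr ⟨X, rfl⟩).elim
    | and a b => exact ho.elim
    | or a b =>
      rcases hv with hv | hv
      · exact ⟨a, v, Or.inl rfl, hv⟩
      · exact ⟨b, v, Or.inr rfl, hv⟩
    | box i a => exact ho.elim
    | dia i a =>
      obtain ⟨u, hu, h⟩ := hv
      exact ⟨a, u, ⟨u, hu, rfl⟩, h⟩
    | mu X a => exact (hf ⟨true, X, a, rfl⟩).elim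
    | nu X a => exact (hf ⟨false, X, a, rfl⟩).elim
  hopp e ψ v hf hvr hv ho χ u hm := by
    cases ψ with
    | prop _ => exact hm.elim
    | nprop _ => exact hm.elim
    | var X => exact (hvr ⟨X, rfl⟩).elim
    | and a b =>
      simp only [evalMove, Prod.mk.injEq] at hm
      rcases hm with ⟨rfl, rfl⟩ | ⟨rfl, rfl⟩
      · exact hv.1
      · exact hv.2
    | or a b => exact (ho trivial).elim
    | box i a =>
      simp only [evalMove, Prod.mk.injEq] at hm
      obtain ⟨v', h1, rfl, rfl⟩ := hm
      exact hv _ h1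
    | dia i a => exact (ho trivial).elim
    | mu X a => exact (hf ⟨true, X, a, rfl⟩).elim
    | nu X a => exact (hf ⟨false, X, a, rfl⟩).elim

lemma semR (M : KModel Λ W) (φ : MuForm Λ) :
    SemOK M φ false (fun x => ¬ evalOwnV M φ x) (fun e ψ => (ψ.sem M (fun x => (e x)ᶜ))ᶜ) where
  mono ψ e e' h := by
    apply Set.compl_subset_compl.2
    apply sem_mono
    intro x
    exact Set.compl_subset_compl.2 (h x)
  var e x := by simp [MuForm.sem]
  bad e X a := by
    simp only [mkfix, MuForm.sem, upd_compl]
    ext v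
    simp only [Set.mem_compl_iff, Set.sSup_eq_sUnion, Set.mem_sUnion, Set.sInf_eq_sInter,
      Set.mem_sInter, Set.mem_setOf_eq]
    constructor
    · intro h A hA
      by_contra hv
      exact h ⟨Aᶜ, Set.compl_subset_comm.1 hA, hv⟩
    · rintro h ⟨A, hA, hv⟩
      exact h Aᶜ (by rw [compl_compl]; exact Set.compl_subset_compl.2 hA) hv
  good e X a := by
    simp only [upd_compl, compl_compl]
    apply Set.compl_subset_compl.2
    show _ ⊆ MuForm.sem M _ (MuForm.mu X a)
    apply le_sInf (α := Set W)
    intro A hA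
    refine Set.Subset.trans (sem_mono M a _ _ (upd_mono _ X ?_)) hA
    exact sInf_le (α := Set W) hA
  hown e ψ v hf hvr hv ho := by
    cases ψ with
    | prop _ => exact (ho hv).elim
    | nprop _ => exact (hv ho).elim
    | var X => exact (hvr ⟨X, rfl⟩).elim
    | or a b => exact (ho trivial).elim
    | and a b =>
      rcases not_and_or.1 hv with hv | hv
      · exact ⟨a, v, Or.inl rfl, hv⟩
      · exact ⟨b, v, Or.inr rfl, hv⟩
    | dia i a => exact (ho trivial).elim
    | box i a =>
      simp only [MuForm.sem, Set.mem_compl_iff, Set.mem_setOf_eq, not_forall] at hv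
      obtain ⟨u, hu, h⟩ := hv
      exact ⟨a, u, ⟨u, hu, rfl⟩, h⟩
    | mu X a => exact (hf ⟨true, X, a, rfl⟩).elim
    | nu X a => exact (hf ⟨false, X, a, rfl⟩).elim
  hopp e ψ v hf hvr hv ho χ u hm := by
    cases ψ with
    | prop _ => exact hm.elim
    | nprop _ => exact hm.elim
    | var X => exact (hvr ⟨X, rfl⟩).elim
    | or a b =>
      simp only [evalMove, Prod.mk.injEq] at hm
      rcases hm with ⟨rfl, rfl⟩ | ⟨rfl, rfl⟩
      · exact fun h => hv (Or.inl h)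
      · exact fun h => hv (Or.inr h)
    | and a b => exact (ho (fun h => h)).elim
    | dia i a =>
      simp only [evalMove, Prod.mk.injEq] at hm
      obtain ⟨v', h1, rfl, rfl⟩ := hm
      exact fun h => hv ⟨_, h1, h⟩
    | box i a => exact (ho (fun h => h)).elim
    | mu X a => exact (hf ⟨true, X, a, rfl⟩).elim
    | nu X a => exact (hf ⟨false, X, a, rfl⟩).elim

end EvalG

/-- `M, w ⊨ φ` iff Verifier has a winning strategy in the
evaluation game `𝒢(M, w ⊨ φ)`, and `M, w ⊭ φ` iff Refuter has a winning
strategy in `𝒢(M, w ⊨ φ)`. -/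
theorem eval_game_correct {Λ W : Type} (M : KModel Λ W) (w : W) (φ : MuForm Λ)
    (hφ : WellNamed φ) (env : ℕ → Set W) :
    (w ∈ MuForm.sem M env φ ↔ (evalGame M w φ).VWins) ∧
    (w ∉ MuForm.sem M env φ ↔ (evalGame M w φ).RWins) := by

  have hV : w ∈ MuForm.sem M env φ → (evalGame M w φ).VWins := fun h =>
    EvalG.core (EvalG.semV M φ) hφ evalWinV (fun q hq => hq) (env0 := env) h
  have hR : w ∉ MuForm.sem M env φ → (evalGame M w φ).RWins := by
    intro h
    refine EvalG.core (EvalG.semR M φ) hφ (fun q => ¬ evalWinV q) ?_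
      (env0 := fun x => (env x)ᶜ) ?_
    · rintro q ⟨X, a, h1, h2⟩ ⟨Y, b, h3, h4⟩
      have e1 := EvalG.sub_sz _ (h2 _ h3)
      have e2 := EvalG.sub_sz _ (h4 _ h1)
      rcases e1 with e1 | e1
      · simp [EvalG.mkfix] at e1
      · rcases e2 with e2 | e2
        · simp [EvalG.mkfix] at e2
        · exact absurd e1 (not_lt.2 e2.le)
    · simpa using h
  refine ⟨⟨hV, fun h => ?_⟩, ⟨hR, fun h h' => EvalG.not_both _ (hV h') h⟩⟩
  by_contra h'
  exact EvalG.not_both _ h (hR h')
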